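/- arXiv:2206.01844 — 2 statements merged into one kernel-verified Lean document; each statement's English description precedes it below -/
import Mathlib

section
/- Let n, d, k ≥ 3, let δ = 1/((k-1)·2^{k+2}) and c = 2k/δ^k. If G is a k-graph on n vertices with maximum degree Δ(G) ≤ d, then ϑ(G) ≤ c · d^{k/2} · log n. -/
open Finset

variable {V : Type*} [DecidableEq V]

/-- `I` is an independent set of the hypergraph `G`: no edge of `G` is contained in `I`. -/
def IsIndep (G : Finset (Finset V)) (I : Finset V) : Prop :=
  ∀ e ∈ G, ¬ e ⊆ I

/-- The degree of a vertex set `S` in the hypergraph `G`: the number of edges containing `S`. -/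
def degS (G : Finset (Finset V)) (S : Finset V) : ℕ :=
  (G.filter fun e => S ⊆ e).card

/-- `ϑ(G)`: the minimum `t` such that there are independent sets `I_1, …, I_t` of `G`
covering every edge of the complement of `G` (i.e. every `k`-set which is not an edge). -/
noncomputable def vartheta (k : ℕ) (G : Finset (Finset V)) : ℕ :=
  sInf {t | ∃ I : Fin t → Finset V,
    (∀ j, IsIndep G (I j)) ∧
    ∀ e : Finset V, e.card = k → e ∉ G → ∃ j, e ⊆ I j}

/-- `G` is a `d`-balanced `k`-graph: `Δ_i(G) ≤ d^{(k-i)/(k-1)}` for all `1 ≤ i ≤ k`. -/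
def IsBalanced (k d : ℕ) (G : Finset (Finset V)) : Prop :=
  ∀ i : ℕ, 1 ≤ i → i ≤ k → ∀ S : Finset V, S.card = i →
    (degS G S : ℝ) ≤ (d : ℝ) ^ (((k : ℝ) - i) / ((k : ℝ) - 1))


/-- The probability that a random subset, containing each point independently with probability `p`,
equals `S`. -/
noncomputable def bernoulliWeight [Fintype V] (p : ℝ) (S : Finset V) : ℝ :=
  p ^ S.card * (1 - p) ^ (Fintype.card V - S.card)

lemma bernoulliWeight_nonneg {α : Type*} [Fintype α] {p : ℝ} (hp₀ : 0 ≤ p) (hp₁ : p ≤ 1)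
    (S : Finset α) :
    0 ≤ bernoulliWeight p S :=
  mul_nonneg (pow_nonneg hp₀ _) (pow_nonneg (sub_nonneg.2 hp₁) _)

lemma sum_bernoulliWeight_superset [Fintype V] (p : ℝ) (A : Finset V) :
    ∑ S with A ⊆ S, bernoulliWeight p S = p ^ A.card := by
  have h : ∑ S with A ⊆ S, bernoulliWeight p S =
      ∑ B ∈ Aᶜ.powerset, p ^ A.card * (p ^ B.card * (1 - p) ^ (Aᶜ.card - B.card)) := by
    refine Finset.sum_bij' (fun S _ => S \ A) (fun B _ => A ∪ B) ?_ ?_ ?_ ?_ ?_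
    · intro S _
      simp only [mem_powerset]
      intro x hx
      simp_all
    · intro B _
      simp
    · intro S hS
      simp only [mem_filter, mem_univ, true_and] at hS
      exact Finset.union_sdiff_of_subset hS
    · intro B hB
      rw [mem_powerset] at hB
      ext x
      have := @hB x
      simp only [mem_compl] at this
      simp only [mem_sdiff, mem_union]
      tauto
    · intro S hS
      simp only [mem_filter, mem_univ, true_and] at hS
      have h1 := Finset.card_sdiff_add_card_eq_card hS
      have h2 := Finset.card_le_univ S
      have h3 := Finset.card_compl A
      rw [← mul_assoc, ← pow_add, bernoulliWeight]
      congr 2 <;> omega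
  rw [h, ← Finset.mul_sum, Finset.sum_pow_mul_eq_add_pow]
  simp

/-- A union bound: if `e ⊆ S` implies `Q S` unless `S` contains a member of `F`, then `Q` holds
with probability at least half that of `e ⊆ S`, provided the members of `F` are unlikely. -/
lemma half_pow_le_sum_bernoulliWeight [Fintype V] {p : ℝ} (hp₀ : 0 ≤ p) (hp₁ : p ≤ 1)
    (e : Finset V) (F : Finset (Finset V)) (hF : ∑ f ∈ F, p ^ (f \ e).card ≤ 1 / 2)
    (Q : Finset V → Prop) [DecidablePred Q]
    (hQ : ∀ S, e ⊆ S → (∀ f ∈ F, ¬ f ⊆ S) → Q S) :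
    p ^ e.card / 2 ≤ ∑ S with Q S, bernoulliWeight p S := by
  have hw := bernoulliWeight_nonneg (α := V) hp₀ hp₁
  have hcov : ∑ S with e ⊆ S, bernoulliWeight p S ≤ ∑ S with Q S, bernoulliWeight p S +
      ∑ f ∈ F, ∑ S with e ∪ f ⊆ S, bernoulliWeight p S := by
    simp only [Finset.sum_filter]
    rw [Finset.sum_comm, ← Finset.sum_add_distrib]
    refine Finset.sum_le_sum fun S _ => ?_
    have hnn : ∀ f ∈ F, 0 ≤ if e ∪ f ⊆ S then bernoulliWeight p S else 0 := by
      intro f _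
      split_ifs
      exacts [hw S, le_rfl]
    have hsum := Finset.sum_nonneg hnn
    by_cases he : e ⊆ S
    · by_cases hq : Q S
      · simpa [he, hq] using hsum
      · have : ∃ f ∈ F, f ⊆ S := by
          by_contra! hc
          exact hq (hQ S he hc)
        obtain ⟨f, hf, hfS⟩ := this
        have h1 := Finset.single_le_sum hnn hf
        simp only [union_subset he hfS, if_true] at h1
        simpa [he, hq] using h1
    · have : 0 ≤ if Q S then bernoulliWeight p S else 0 := by
        split_ifs
        exacts [hw S, le_rfl]
      simp only [he, if_false]
      positivity
  have hF' : ∑ f ∈ F, ∑ S with e ∪ f ⊆ S, bernoulliWeight p S =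
      p ^ e.card * ∑ f ∈ F, p ^ (f \ e).card := by
    rw [Finset.mul_sum]
    refine Finset.sum_congr rfl fun f _ => ?_
    rw [sum_bernoulliWeight_superset, ← pow_add, ← Finset.card_union_of_disjoint
      Finset.disjoint_sdiff, Finset.union_sdiff_self_eq_union]
  rw [sum_bernoulliWeight_superset, hF'] at hcov
  nlinarith [pow_nonneg hp₀ e.card]

/-- Greedy covering: if every target is hit with probability at least `q`, some `t` choices
leave at most a fraction `(1 - q) ^ t` of the targets unhit. -/
lemma exists_greedy_cover {ι α : Type*} [Fintype ι] [DecidableEq α] (w : ι → ℝ)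
    (hw : ∀ i, 0 ≤ w i) (hw₁ : ∑ i, w i = 1) (r : α → ι → Prop) [∀ a i, Decidable (r a i)]
    {q : ℝ} (hq₁ : q ≤ 1) (E : Finset α) (hE : ∀ a ∈ E, q ≤ ∑ i with r a i, w i) (t : ℕ) :
    ∃ s : Fin t → ι, ((E.filter fun a => ∀ j, ¬ r a (s j)).card : ℝ) ≤ (1 - q) ^ t * E.card := by
  induction t with
  | zero => exact ⟨Fin.elim0, by simp⟩
  | succ t ih =>
    obtain ⟨s, hs⟩ := ih
    set U := E.filter fun a => ∀ j, ¬ r a (s j) with hU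
    have havg : ∑ i, w i * ((U.filter fun a => ¬ r a i).card : ℝ) ≤
        ∑ i, w i * ((1 - q) * U.card) := by
      have h1 : ∑ i, w i * ((U.filter fun a => ¬ r a i).card : ℝ) =
          ∑ a ∈ U, ∑ i with ¬ r a i, w i := by
        simp only [Finset.card_filter, Nat.cast_sum, Finset.mul_sum, Finset.sum_filter]
        rw [Finset.sum_comm]
        refine Finset.sum_congr rfl fun a _ => Finset.sum_congr rfl fun i _ => ?_
        split_ifs <;> simp
      rw [h1, ← Finset.sum_mul, hw₁, one_mul, mul_comm, ← nsmul_eq_mul]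
      refine Finset.sum_le_card_nsmul _ _ _ fun a ha => ?_
      have h2 := hE a (Finset.mem_filter.1 ha).1
      have h3 := Finset.sum_filter_add_sum_filter_not Finset.univ (r a) w
      linarith
    have hne : (Finset.univ : Finset ι).Nonempty := by
      by_contra hne
      rw [Finset.not_nonempty_iff_eq_empty] at hne
      simp [hne] at hw₁
    have hex : ∃ i, ((U.filter fun a => ¬ r a i).card : ℝ) ≤ (1 - q) * U.card := by
      by_contra! hc
      obtain ⟨i, -, hi⟩ : ∃ i ∈ Finset.univ, 0 < w i := by
        by_contra! hz
        have := Finset.sum_nonpos hz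
        linarith
      refine absurd havg (not_le.2 (Finset.sum_lt_sum
        (fun i _ => mul_le_mul_of_nonneg_left (hc i).le (hw i)) ⟨i, Finset.mem_univ i, ?_⟩))
      exact mul_lt_mul_of_pos_left (hc i) hi
    obtain ⟨i, hi⟩ := hex
    refine ⟨Fin.cons i s, ?_⟩
    have heq : (E.filter fun a => ∀ j, ¬ r a ((Fin.cons i s : Fin (t + 1) → ι) j)) =
        U.filter fun a => ¬ r a i := by
      ext a
      simp only [hU, Finset.mem_filter, Fin.forall_fin_succ, Fin.cons_zero, Fin.cons_succ]
      tauto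
    rw [heq, pow_succ']
    calc _ ≤ _ := hi
      _ ≤ (1 - q) * ((1 - q) ^ t * E.card) :=
        mul_le_mul_of_nonneg_left hs (sub_nonneg.2 hq₁)
      _ = _ := by ring

lemma degS_anti (G : Finset (Finset V)) {A B : Finset V} (h : A ⊆ B) : degS G B ≤ degS G A :=
  Finset.card_le_card (Finset.monotone_filter_right _ fun _ _ hB => h.trans hB)

lemma degS_le_of_nonempty {G : Finset (Finset V)} {d : ℕ} (hΔ : ∀ v, degS G {v} ≤ d)
    {A : Finset V} (hA : A.Nonempty) : degS G A ≤ d := by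
  obtain ⟨v, hv⟩ := hA
  exact (degS_anti G (Finset.singleton_subset_iff.2 hv)).trans (hΔ v)

lemma sum_degS_insert_le {G : Finset (Finset V)} {k : ℕ} (hG : ∀ e ∈ G, e.card = k)
    (R W : Finset V) (hRW : Disjoint R W) :
    ∑ w ∈ W, degS G (insert w R) ≤ (k - R.card) * degS G R := by
  have h : ∑ w ∈ W, degS G (insert w R) =
      ∑ f ∈ G.filter fun f => R ⊆ f, (W.filter fun w => w ∈ f).card := by
    simp only [degS, Finset.card_filter, Finset.sum_filter, Finset.insert_subset_iff]
    rw [Finset.sum_comm]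
    refine Finset.sum_congr rfl fun f _ => ?_
    by_cases hf : R ⊆ f <;> simp [hf]
  rw [h, mul_comm, ← smul_eq_mul, degS]
  refine Finset.sum_le_card_nsmul _ _ _ fun f hf => ?_
  rw [Finset.mem_filter] at hf
  rw [← hG f hf.1, ← Finset.card_sdiff_of_subset hf.2]
  refine Finset.card_le_card fun w hw => ?_
  rw [Finset.mem_filter] at hw
  exact Finset.mem_sdiff.2 ⟨hw.2, fun h => Finset.disjoint_left.1 hRW h hw.1⟩

/-- `v` is a vertex of `f` whose removal leaves a set of largest possible degree. -/
def IsTopVertex (G : Finset (Finset V)) (f : Finset V) (v : V) : Prop :=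
  v ∈ f ∧ ∀ u ∈ f, degS G (f.erase u) ≤ degS G (f.erase v)

instance (G : Finset (Finset V)) (f : Finset V) : DecidablePred (IsTopVertex G f) :=
  fun _ => instDecidableAnd

/-- Delete from `S` every top vertex of every edge contained in `S`. -/
def prune (G : Finset (Finset V)) (S : Finset V) : Finset V :=
  S.filter fun v => ∀ f ∈ G, IsTopVertex G f v → ¬ f ⊆ S

lemma isIndep_prune {G : Finset (Finset V)} (hG : ∀ f ∈ G, f.Nonempty) (S : Finset V) :
    IsIndep G (prune G S) := by
  intro f hf hfS
  obtain ⟨v, hv, hmax⟩ := Finset.exists_max_image f (fun u => degS G (f.erase u)) (hG f hf)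
  exact (Finset.mem_filter.1 (hfS hv)).2 f hf ⟨hv, hmax⟩ (hfS.trans (Finset.filter_subset _ _))

/-- The edges having a top vertex in `e`. -/
def threats (G : Finset (Finset V)) (e : Finset V) : Finset (Finset V) :=
  G.filter fun f => ∃ v ∈ e, IsTopVertex G f v

lemma subset_prune {G : Finset (Finset V)} {e S : Finset V} (heS : e ⊆ S)
    (h : ∀ f ∈ threats G e, ¬ f ⊆ S) : e ⊆ prune G S := fun v hv =>
  Finset.mem_filter.2 ⟨heS hv, fun f hf hfv => h f (Finset.mem_filter.2 ⟨hf, v, hv, hfv⟩)⟩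

lemma card_filter_inter_nonempty_le {G : Finset (Finset V)} {d : ℕ} (hΔ : ∀ v, degS G {v} ≤ d)
    (e : Finset V) : (G.filter fun f => (e ∩ f).Nonempty).card ≤ e.card * d := by
  have h : G.filter (fun f => (e ∩ f).Nonempty) ⊆
      e.biUnion fun v => G.filter fun f => {v} ⊆ f := by
    intro f hf
    obtain ⟨hfG, v, hv⟩ := Finset.mem_filter.1 hf
    rw [Finset.mem_inter] at hv
    simp only [Finset.mem_biUnion, Finset.mem_filter, Finset.singleton_subset_iff]
    exact ⟨v, hv.1, hfG, hv.2⟩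
  exact (Finset.card_le_card h).trans (Finset.card_biUnion_le_card_mul _ _ _ fun v _ => hΔ v)

open Classical in
/-- The number of ways to extend `R`, missing two vertices of an edge, to a set of degree above
`√d`. -/
lemma card_large_extensions_le [Fintype V] {G : Finset (Finset V)} {k d : ℕ} (hd : 0 < d)
    (hG : ∀ e ∈ G, e.card = k) (hΔ : ∀ v, degS G {v} ≤ d) {R : Finset V} (hR : R.Nonempty)
    (hRk : R.card + 2 = k) :
    (((Rᶜ).filter fun w => √(d : ℝ) < degS G (insert w R)).card : ℝ) ≤ 2 * √d := by
  set W := (Rᶜ).filter fun w => √(d : ℝ) < degS G (insert w R) with hW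
  have hdisj : Disjoint R W :=
    Finset.disjoint_left.2 fun x hx hxW =>
      Finset.mem_compl.1 (Finset.mem_filter.1 hxW).1 hx
  have h1 : W.card * √(d : ℝ) ≤ ∑ w ∈ W, (degS G (insert w R) : ℝ) := by
    rw [← nsmul_eq_mul]
    exact Finset.card_nsmul_le_sum _ _ _ fun w hw => (Finset.mem_filter.1 hw).2.le
  have h2 : ∑ w ∈ W, (degS G (insert w R) : ℝ) ≤ 2 * d := by
    have h3 := sum_degS_insert_le hG R W hdisj
    rw [show k - R.card = 2 by omega] at h3
    exact_mod_cast h3.trans (Nat.mul_le_mul_left 2 (degS_le_of_nonempty hΔ hR))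
  have h4 : 0 < √(d : ℝ) := Real.sqrt_pos.2 (by exact_mod_cast hd)
  have h5 := Real.mul_self_sqrt (Nat.cast_nonneg (α := ℝ) d)
  refine le_of_mul_le_mul_right ?_ h4
  linarith

/-- Few threats to a non-edge `e` leave `e` in only one vertex. -/
lemma card_threats_sdiff_le_one [Fintype V] {G : Finset (Finset V)} {k d : ℕ} (hk : 3 ≤ k)
    (hd : 0 < d) (hG : ∀ e ∈ G, e.card = k) (hΔ : ∀ v, degS G {v} ≤ d) {e : Finset V}
    (he : e.card = k) (heG : e ∉ G) :
    (((threats G e).filter fun f => (f \ e).card ≤ 1).card : ℝ) ≤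
      k * √d + k * (k - 1) * (2 * √d) := by
  classical
  set A := (e.filter fun u => (degS G (e.erase u) : ℝ) ≤ √d).biUnion
    fun u => G.filter fun f => e.erase u ⊆ f with hA
  set B := e.biUnion fun u => (e.erase u).biUnion fun v =>
    ((((e.erase u).erase v)ᶜ).filter fun w =>
      √(d : ℝ) < degS G (insert w ((e.erase u).erase v))).image
        fun w => insert w (e.erase u) with hB
  have hsub : (threats G e).filter (fun f => (f \ e).card ≤ 1) ⊆ A ∪ B := by
    intro f hf
    rw [Finset.mem_filter] at hf
    obtain ⟨hft, hf1⟩ := hf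
    obtain ⟨hfG, v, hve, hvf, hmax⟩ := Finset.mem_filter.1 hft
    have hfk := hG f hfG
    have hcard : (e \ f).card = (f \ e).card :=
      Finset.card_sdiff_comm (he.trans hfk.symm)
    have hpos : (f \ e).card ≠ 0 := by
      intro h0
      rw [Finset.card_eq_zero, Finset.sdiff_eq_empty_iff_subset] at h0
      exact heG (Finset.eq_of_subset_of_card_le h0 (by omega) ▸ hfG)
    obtain ⟨w, hw⟩ := Finset.card_eq_one.1 (show (f \ e).card = 1 by omega)
    obtain ⟨u, hu⟩ := Finset.card_eq_one.1 (show (e \ f).card = 1 by omega)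
    have hw' : ∀ x, (x ∈ f ∧ x ∉ e) ↔ x = w := by
      intro x; rw [← Finset.mem_sdiff, hw, Finset.mem_singleton]
    have hu' : ∀ x, (x ∈ e ∧ x ∉ f) ↔ x = u := by
      intro x; rw [← Finset.mem_sdiff, hu, Finset.mem_singleton]
    have hwf := (hw' w).2 rfl
    have huf := (hu' u).2 rfl
    have hfw : f.erase w = e.erase u := by
      ext x
      have h1 := hw' x
      have h2 := hu' x
      simp only [Finset.mem_erase]
      tauto
    have hins : insert w (e.erase u) = f := by rw [← hfw, Finset.insert_erase hwf.1]
    rw [Finset.mem_union]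
    by_cases hs : (degS G (e.erase u) : ℝ) ≤ √d
    · left
      simp only [hA, Finset.mem_biUnion, Finset.mem_filter]
      exact ⟨u, ⟨huf.1, hs⟩, hfG, hfw ▸ Finset.erase_subset _ _⟩
    · right
      have hvu : v ≠ u := fun h => huf.2 (h ▸ hvf)
      have hwv : w ≠ v := fun h => hwf.2 (h ▸ hve)
      simp only [hB, Finset.mem_biUnion, Finset.mem_image, Finset.mem_filter]
      refine ⟨u, huf.1, v, Finset.mem_erase.2 ⟨hvu, hve⟩, w, ⟨?_, ?_⟩, hins⟩
      · simp [hwf.2]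
      · have h1 : insert w ((e.erase u).erase v) = f.erase v := by
          rw [← Finset.erase_insert_of_ne hwv, hins]
        have h2 := hmax w hwf.1
        rw [h1]
        rw [hfw] at h2
        exact (not_le.1 hs).trans_le (by exact_mod_cast h2)
  have hAcard : (A.card : ℝ) ≤ k * √d := by
    calc (A.card : ℝ) ≤ ∑ u ∈ e.filter fun u => (degS G (e.erase u) : ℝ) ≤ √d,
          (degS G (e.erase u) : ℝ) := by exact_mod_cast Finset.card_biUnion_le
      _ ≤ ((e.filter fun u => (degS G (e.erase u) : ℝ) ≤ √d).card : ℝ) * √d := by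
          rw [← nsmul_eq_mul]
          exact Finset.sum_le_card_nsmul _ _ _ fun u hu => (Finset.mem_filter.1 hu).2
      _ ≤ k * √d := by
          refine mul_le_mul_of_nonneg_right ?_ (Real.sqrt_nonneg _)
          exact_mod_cast he ▸ Finset.card_filter_le _ _
  have hBcard : (B.card : ℝ) ≤ k * (k - 1) * (2 * √d) := by
    have hone : ∀ u ∈ e, ∀ v ∈ e.erase u,
        ((((((e.erase u).erase v)ᶜ).filter fun w =>
          √(d : ℝ) < degS G (insert w ((e.erase u).erase v))).image
            fun w => insert w (e.erase u)).card : ℝ) ≤ 2 * √d := by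
      intro u hu v hv
      have hc : ((e.erase u).erase v).card + 2 = k := by
        rw [Finset.card_erase_of_mem hv, Finset.card_erase_of_mem hu]
        omega
      refine le_trans ?_ (card_large_extensions_le hd hG hΔ
        (Finset.card_pos.1 (by omega)) hc)
      exact_mod_cast Finset.card_image_le
    have htwo : ∀ u ∈ e, ((((e.erase u).biUnion fun v =>
        ((((e.erase u).erase v)ᶜ).filter fun w =>
          √(d : ℝ) < degS G (insert w ((e.erase u).erase v))).image
            fun w => insert w (e.erase u)).card : ℕ) : ℝ) ≤ (k - 1) * (2 * √d) := by
      intro u hu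
      have hc : ((e.erase u).card : ℝ) = k - 1 := by
        rw [Finset.card_erase_of_mem hu, he, Nat.cast_sub (by omega), Nat.cast_one]
      rw [← hc, ← nsmul_eq_mul]
      refine le_trans ?_ (Finset.sum_le_card_nsmul _ _ _ (hone u hu))
      exact_mod_cast Finset.card_biUnion_le
    have hsum := Finset.sum_le_card_nsmul _ _ _ htwo
    rw [nsmul_eq_mul, he, ← mul_assoc] at hsum
    refine le_trans ?_ hsum
    exact_mod_cast Finset.card_biUnion_le
  have := (Finset.card_le_card hsub).trans (Finset.card_union_le A B)
  have : (((threats G e).filter fun f => (f \ e).card ≤ 1).card : ℝ) ≤ A.card + B.card := by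
    exact_mod_cast this
  linarith

lemma sum_threats_le [Fintype V] {G : Finset (Finset V)} {k d : ℕ} (hk : 3 ≤ k)
    (hd : 0 < d) (hG : ∀ e ∈ G, e.card = k) (hΔ : ∀ v, degS G {v} ≤ d) {e : Finset V}
    (he : e.card = k) (heG : e ∉ G) {p : ℝ} (hp₀ : 0 ≤ p) (hp₁ : p ≤ 1) :
    ∑ f ∈ threats G e, p ^ (f \ e).card ≤
      (k * √d + k * (k - 1) * (2 * √d)) * p + k * d * p ^ 2 := by
  rw [← Finset.sum_filter_add_sum_filter_not (threats G e) fun f => (f \ e).card ≤ 1]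
  refine add_le_add ?_ ?_
  · refine le_trans ?_ (mul_le_mul_of_nonneg_right
      (card_threats_sdiff_le_one hk hd hG hΔ he heG) hp₀)
    rw [← nsmul_eq_mul]
    refine Finset.sum_le_card_nsmul _ _ _ fun f hf => ?_
    have hfG := (Finset.mem_filter.1 (Finset.mem_filter.1 hf).1).1
    have hpos : (f \ e).card ≠ 0 := by
      intro h0
      rw [Finset.card_eq_zero, Finset.sdiff_eq_empty_iff_subset] at h0
      exact heG (Finset.eq_of_subset_of_card_le h0 (by rw [hG f hfG, he]) ▸ hfG)
    have := (Finset.mem_filter.1 hf).2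
    rw [show (f \ e).card = 1 by omega, pow_one]
  · have hc : (((threats G e).filter fun f => ¬ (f \ e).card ≤ 1).card : ℝ) ≤ k * d := by
      have h1 : (threats G e).filter (fun f => ¬ (f \ e).card ≤ 1) ⊆
          G.filter fun f => (e ∩ f).Nonempty := by
        intro f hf
        obtain ⟨hfG, v, hve, hvf, -⟩ := Finset.mem_filter.1 (Finset.mem_filter.1 hf).1
        exact Finset.mem_filter.2 ⟨hfG, v, Finset.mem_inter.2 ⟨hve, hvf⟩⟩
      have h2 := (Finset.card_le_card h1).trans (card_filter_inter_nonempty_le hΔ e)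
      rw [he] at h2
      exact_mod_cast h2
    refine le_trans ?_ (mul_le_mul_of_nonneg_right hc (sq_nonneg p))
    rw [← nsmul_eq_mul]
    refine Finset.sum_le_card_nsmul _ _ _ fun f hf => ?_
    have := (Finset.mem_filter.1 hf).2
    exact pow_le_pow_of_le_one hp₀ hp₁ (by omega)

lemma vartheta_le_of_lt_one [Fintype V] {G : Finset (Finset V)} {k : ℕ}
    (hG : ∀ f ∈ G, f.Nonempty) {p : ℝ} (hp₀ : 0 ≤ p) (hp₁ : p ≤ 1)
    (hF : ∀ e : Finset V, e.card = k → e ∉ G → ∑ f ∈ threats G e, p ^ (f \ e).card ≤ 1 / 2)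
    (t : ℕ) (ht : (1 - p ^ k / 2) ^ t * ((Fintype.card V).choose k : ℝ) < 1) :
    vartheta k G ≤ t := by
  classical
  have hpk₀ := pow_nonneg hp₀ k
  have hpk := pow_le_one₀ hp₀ hp₁ (n := k)
  set E := (Finset.univ.powersetCard k).filter fun e : Finset V => e ∉ G with hE
  have hw₁ : ∑ S : Finset V, bernoulliWeight p S = 1 := by
    simpa using sum_bernoulliWeight_superset p (∅ : Finset V)
  have hmem : ∀ e, e ∈ E ↔ e.card = k ∧ e ∉ G := by simp [hE]
  obtain ⟨s, hs⟩ := exists_greedy_cover (bernoulliWeight (V := V) p)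
    (bernoulliWeight_nonneg hp₀ hp₁) hw₁ (fun e S => e ⊆ prune G S) (q := p ^ k / 2)
    (by linarith) E (fun e he => by
      obtain ⟨hek, heG⟩ := (hmem e).1 he
      rw [← hek]
      exact half_pow_le_sum_bernoulliWeight hp₀ hp₁ e _ (hF e hek heG) _
        fun S => subset_prune) t
  have hEc : (E.card : ℝ) ≤ (Fintype.card V).choose k := by
    have : E.card ≤ _ := Finset.card_filter_le _ _
    rw [Finset.card_powersetCard, Finset.card_univ] at this
    exact_mod_cast this
  have hlt := (hs.trans (mul_le_mul_of_nonneg_left hEc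
    (pow_nonneg (by linarith : (0 : ℝ) ≤ 1 - p ^ k / 2) t))).trans_lt ht
  have hzero : (E.filter fun e => ∀ j, ¬ e ⊆ prune G (s j)) = ∅ := by
    rw [← Finset.card_eq_zero]
    have : (E.filter fun e => ∀ j, ¬ e ⊆ prune G (s j)).card < 1 := by exact_mod_cast hlt
    omega
  refine Nat.sInf_le ⟨fun j => prune G (s j), fun j => isIndep_prune hG _, fun e hek heG => ?_⟩
  by_contra! hc
  exact Finset.notMem_empty e (hzero ▸ Finset.mem_filter.2 ⟨(hmem e).2 ⟨hek, heG⟩, hc⟩)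

lemma one_sub_pow_mul_choose_lt_one {n k : ℕ} (hn : 0 < n) (hk : 3 ≤ k) {q : ℝ} (hq₀ : 0 < q)
    (hq₁ : q ≤ 1) : (1 - q) ^ ⌊k * Real.log n / q⌋₊ * (n.choose k : ℝ) < 1 := by
  set t := ⌊k * Real.log n / q⌋₊ with ht
  have hn' : (0 : ℝ) < n := by exact_mod_cast hn
  have h1 : k * Real.log n - q < q * t := by
    have := Nat.lt_floor_add_one (k * Real.log n / q)
    rw [div_lt_iff₀ hq₀] at this
    linarith
  have h2 : (1 - q) ^ t ≤ Real.exp (-(q * t)) := by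
    calc (1 - q) ^ t ≤ Real.exp (-q) ^ t :=
          pow_le_pow_left₀ (by linarith) (Real.one_sub_le_exp_neg q) t
      _ = Real.exp (-(q * t)) := by rw [← Real.exp_nat_mul]; ring_nf
  have h3 : Real.exp (-(q * t)) < Real.exp 1 / (n : ℝ) ^ k := by
    rw [← Real.exp_log (pow_pos hn' k), ← Real.exp_sub, Real.log_pow, Real.exp_lt_exp]
    linarith
  have h4 : (n.choose k : ℝ) ≤ (n : ℝ) ^ k / 6 := by
    refine (Nat.choose_le_pow_div k n).trans ?_
    have h6 : (6 : ℝ) ≤ k.factorial := by exact_mod_cast Nat.factorial_le hk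
    gcongr
  have h5 := Real.exp_one_lt_d9
  calc (1 - q) ^ t * (n.choose k : ℝ) ≤ Real.exp 1 / (n : ℝ) ^ k * ((n : ℝ) ^ k / 6) :=
        mul_le_mul (h2.trans h3.le) h4 (Nat.cast_nonneg _) (by positivity)
    _ = Real.exp 1 / 6 := by field_simp
    _ < 1 := by linarith

lemma threat_bound {k : ℕ} (hk : 3 ≤ k) {δ : ℝ}
    (hδ : δ = 1 / (((k : ℝ) - 1) * 2 ^ (k + 2))) :
    0 < δ ∧ δ ≤ 1 ∧ k * δ + k * (k - 1) * (2 * δ) + k * δ ^ 2 ≤ 1 / 2 := by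
  have hk' : (3 : ℝ) ≤ k := by exact_mod_cast hk
  have h2 : 2 * (k : ℝ) ≤ 2 ^ k := by
    obtain ⟨m, rfl⟩ : ∃ m, k = m + 1 := ⟨k - 1, by omega⟩
    have := Nat.lt_two_pow_self (n := m)
    rw [pow_succ]
    have : ((m + 1 : ℕ) : ℝ) ≤ 2 ^ m := by exact_mod_cast this
    linarith
  have hpos : 0 < ((k : ℝ) - 1) * 2 ^ (k + 2) := mul_pos (by linarith) (by positivity)
  have hδ₀ : 0 < δ := hδ ▸ one_div_pos.2 hpos
  have hprod : δ * (k - 1) * (4 * 2 ^ k) = 1 := by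
    rw [hδ, pow_add]
    field_simp [show (k : ℝ) - 1 ≠ 0 by linarith]
    norm_num
  have hx : 0 < δ * (k - 1) := mul_pos hδ₀ (by linarith)
  have hkx : δ * (k - 1) * (8 * k) ≤ 1 := by nlinarith
  have hδk : δ * k ≤ 3 / 2 * (δ * (k - 1)) := by nlinarith
  have hδ₁ : δ ≤ 1 := by nlinarith
  refine ⟨hδ₀, hδ₁, ?_⟩
  have h3 : k * δ ^ 2 ≤ k * δ := by nlinarith
  nlinarith

/-- Let `n, d, k ≥ 3`, `δ = 1/((k-1) 2^{k+2})` and `c = 2k/δ^k`. If `G` is a `k`-graph on `n`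
vertices with `Δ(G) ≤ d`, then `ϑ(G) ≤ c d^{k/2} log n`. -/
theorem bounded_degree_upper (n d k : ℕ) (hn : 3 ≤ n) (hd : 3 ≤ d) (hk : 3 ≤ k)
    (G : Finset (Finset (Fin n))) (hG : ∀ e ∈ G, e.card = k)
    (hΔ : ∀ v : Fin n, degS G {v} ≤ d) (δ c : ℝ)
    (hδ : δ = 1 / (((k : ℝ) - 1) * 2 ^ (k + 2))) (hc : c = 2 * (k : ℝ) / δ ^ k) :
    (vartheta k G : ℝ) ≤ c * (d : ℝ) ^ ((k : ℝ) / 2) * Real.log n := by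
  obtain ⟨hδ₀, hδ₁, hδ₂⟩ := threat_bound hk hδ
  have hd₁ : (1 : ℝ) ≤ √d := Real.one_le_sqrt.2 (by exact_mod_cast (by omega : 1 ≤ d))
  have hd₀ : 0 < √(d : ℝ) := by linarith
  have hdd := Real.sq_sqrt (Nat.cast_nonneg (α := ℝ) d)
  set p := δ / √d with hp
  have hp₀ : 0 < p := div_pos hδ₀ hd₀
  have hp₁ : p ≤ 1 := (div_le_one hd₀).2 (hδ₁.trans hd₁)
  have hpd : √d * p = δ := mul_div_cancel₀ _ hd₀.ne'
  have hpk₁ := pow_le_one₀ hp₀.le hp₁ (n := k)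
  have hF : ∀ e : Finset (Fin n), e.card = k → e ∉ G →
      ∑ f ∈ threats G e, p ^ (f \ e).card ≤ 1 / 2 := by
    intro e he heG
    refine (sum_threats_le hk (by omega) hG hΔ he heG hp₀.le hp₁).trans (le_trans (le_of_eq ?_) hδ₂)
    rw [← hpd, mul_pow, hdd]
    ring
  have hpow : (d : ℝ) ^ ((k : ℝ) / 2) = √d ^ k := by
    rw [Real.sqrt_eq_rpow, ← Real.rpow_mul_natCast (Nat.cast_nonneg d)]
    congr 1
    ring
  have hX : c * (d : ℝ) ^ ((k : ℝ) / 2) * Real.log n = k * Real.log n / (p ^ k / 2) := by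
    rw [hc, hpow, hp, div_pow]
    field_simp
  rw [hX]
  have hle := vartheta_le_of_lt_one (fun f hf => Finset.card_pos.1 (by rw [hG f hf]; omega))
    hp₀.le hp₁ hF ⌊k * Real.log n / (p ^ k / 2)⌋₊ (by
      rw [Fintype.card_fin]
      exact one_sub_pow_mul_choose_lt_one (by omega) hk (by positivity) (by linarith))
  refine (Nat.cast_le.2 hle).trans (Nat.floor_le ?_)
  have := Real.log_natCast_nonneg n
  positivity
end

section
/- There is a positive constant c such that for all n, d ≥ 2 and all even k ≥ 2 there exists a k-graph G on n vertices with maximum degree Δ(G) ≤ d and ϑ(G) ≥ c · (d^2 / log d) · log(2n / (kd)). -/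
open Finset

variable {V : Type*} [DecidableEq V]

/-- The blow-up of the graph `H`: every vertex `w` is replaced by the vertex set `B w`, and every
edge by the union of the sets of its two ends. -/
noncomputable def blowUp {W : Type*} [Fintype W] (B : W → Finset V) (H : SimpleGraph W) :
    Finset (Finset V) := by
  classical
  exact (univ.filter fun p : W × W => H.Adj p.1 p.2).image fun p => B p.1 ∪ B p.2

theorem mem_blowUp {W : Type*} [Fintype W] {B : W → Finset V} {H : SimpleGraph W}
    {e : Finset V} : e ∈ blowUp B H ↔ ∃ w w', H.Adj w w' ∧ B w ∪ B w' = e := by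
  simp [blowUp]

theorem union_mem_blowUp_iff {W : Type*} [Fintype W] {B : W → Finset V} {H : SimpleGraph W}
    (hne : ∀ w, (B w).Nonempty) (hB : ∀ w w' v, v ∈ B w → v ∈ B w' → w = w') {w w' : W}
    (hww : w ≠ w') : B w ∪ B w' ∈ blowUp B H ↔ H.Adj w w' := by
  rw [mem_blowUp]
  refine ⟨?_, fun h => ⟨w, w', h, rfl⟩⟩
  rintro ⟨x, y, hxy, he⟩
  have key : ∀ z, B z ⊆ B x ∪ B y → z = x ∨ z = y := by
    intro z hz
    obtain ⟨v, hv⟩ := hne z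
    rcases mem_union.1 (hz hv) with h | h
    · exact Or.inl (hB _ _ v hv h)
    · exact Or.inr (hB _ _ v hv h)
  have h1 := key w (he ▸ subset_union_left)
  have h2 := key w' (he ▸ subset_union_right)
  rcases h1 with rfl | rfl <;> rcases h2 with rfl | rfl
  · exact absurd rfl hww
  · exact hxy
  · exact hxy.symm
  · exact absurd rfl hww

theorem card_of_mem_blowUp {W : Type*} [Fintype W] {B : W → Finset V} {H : SimpleGraph W}
    {s : ℕ} (hs : ∀ w, (B w).card = s) (hB : ∀ w w' v, v ∈ B w → v ∈ B w' → w = w')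
    {e : Finset V} (he : e ∈ blowUp B H) : e.card = 2 * s := by
  obtain ⟨w, w', h, rfl⟩ := mem_blowUp.1 he
  rw [card_union_of_disjoint, hs, hs, two_mul]
  exact disjoint_left.2 fun v hv hv' => h.ne (hB _ _ v hv hv')

theorem degS_blowUp_le {W : Type*} [Fintype W] {B : W → Finset V} {H : SimpleGraph W} {d : ℕ}
    (hB : ∀ w w' v, v ∈ B w → v ∈ B w' → w = w')
    (hd : ∀ w, ∃ N : Finset W, N.card ≤ d ∧ ∀ w', H.Adj w w' → w' ∈ N) (v : V) :
    degS (blowUp B H) {v} ≤ d := by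
  classical
  by_cases hv : ∃ w, v ∈ B w
  · obtain ⟨w, hw⟩ := hv
    obtain ⟨N, hN, hadj⟩ := hd w
    refine le_trans (le_trans (card_le_card (t := N.image fun w' => B w ∪ B w') ?_)
      card_image_le) hN
    intro e he
    obtain ⟨heG, hve⟩ := mem_filter.1 he
    obtain ⟨x, y, hxy, rfl⟩ := mem_blowUp.1 heG
    rw [mem_image]
    rcases mem_union.1 (singleton_subset_iff.1 hve) with h | h
    · obtain rfl := hB _ _ v hw h
      exact ⟨y, hadj _ hxy, rfl⟩
    · obtain rfl := hB _ _ v hw h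
      exact ⟨x, hadj _ hxy.symm, union_comm _ _⟩
  · have : (blowUp B H).filter (fun e => {v} ⊆ e) = ∅ := by
      refine filter_eq_empty_iff.2 fun e he hve => hv ?_
      obtain ⟨x, y, -, rfl⟩ := mem_blowUp.1 he
      rcases mem_union.1 (singleton_subset_iff.1 hve) with h | h
      exacts [⟨x, h⟩, ⟨y, h⟩]
    rw [degS, this, card_empty]
    exact Nat.zero_le d

theorem exists_cover_vartheta [Fintype V] {k : ℕ} {G : Finset (Finset V)}
    (hG : ∀ e ∈ G, e.card = k) :
    ∃ I : Fin (vartheta k G) → Finset V, (∀ j, IsIndep G (I j)) ∧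
      ∀ e : Finset V, e.card = k → e ∉ G → ∃ j, e ⊆ I j := by
  classical
  refine Nat.sInf_mem (s := {t | ∃ I : Fin t → Finset V, (∀ j, IsIndep G (I j)) ∧
    ∀ e : Finset V, e.card = k → e ∉ G → ∃ j, e ⊆ I j}) ?_
  let S : Finset (Finset V) := univ.filter fun e => e.card = k ∧ e ∉ G
  refine ⟨S.card, fun j => (S.equivFin.symm j : Finset V), fun j e he hsub => ?_,
    fun e he heG => ?_⟩
  · have hj := (mem_filter.1 (S.equivFin.symm j).2).2
    have := eq_of_subset_of_card_le hsub (by rw [hj.1, hG e he])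
    subst this
    exact hj.2 he
  · refine ⟨S.equivFin ⟨e, mem_filter.2 ⟨mem_univ _, he, heG⟩⟩, ?_⟩
    simp

theorem exists_cover_of_vartheta_le [Fintype V] {k t : ℕ} (hk : 0 < k) {G : Finset (Finset V)}
    (hG : ∀ e ∈ G, e.card = k) (ht : vartheta k G ≤ t) :
    ∃ I : Fin t → Finset V, (∀ j, IsIndep G (I j)) ∧
      ∀ e : Finset V, e.card = k → e ∉ G → ∃ j, e ⊆ I j := by
  obtain ⟨I, hI, hcov⟩ := exists_cover_vartheta hG
  refine ⟨fun j => if hj : (j : ℕ) < vartheta k G then I ⟨j, hj⟩ else ∅, fun j => ?_,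
    fun e he heG => ?_⟩
  · dsimp only
    split_ifs with hj
    · exact hI _
    · intro e he hsub
      have := hG e he
      rw [subset_empty.1 hsub, card_empty] at this
      omega
  · obtain ⟨j, hj⟩ := hcov e he heG
    exact ⟨Fin.castLE ht j, by simpa using hj⟩

/-- Two families of `h` disjoint cliques of size `a`, where for all positions `p`, `q` the vertices
at position `p` on the left are matched to those at position `q` on the right by `π p q`. -/
def matchedCliques {a h : ℕ} (π : Fin a → Fin a → Equiv.Perm (Fin h)) :
    SimpleGraph ((Fin h ⊕ Fin h) × Fin a) where
  Adj
    | (.inl i, p), (.inl j, q) => i = j ∧ p ≠ q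
    | (.inr i, p), (.inr j, q) => i = j ∧ p ≠ q
    | (.inl i, p), (.inr j, q) => π p q i = j
    | (.inr j, q), (.inl i, p) => π p q i = j
  symm := by
    constructor
    rintro ⟨i | i, p⟩ ⟨j | j, q⟩ h
    · exact ⟨h.1.symm, h.2.symm⟩
    · exact h
    · exact h
    · exact ⟨h.1.symm, h.2.symm⟩
  loopless := by
    constructor
    rintro ⟨i | i, p⟩ h
    exacts [h.2 rfl, h.2 rfl]

theorem matchedCliques_adj_of_ne {a h : ℕ} (π : Fin a → Fin a → Equiv.Perm (Fin h))
    (b : Fin h ⊕ Fin h) {p q : Fin a} (hpq : p ≠ q) : (matchedCliques π).Adj (b, p) (b, q) := by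
  cases b <;> exact ⟨rfl, hpq⟩

theorem matchedCliques_adj_inl_inr {a h : ℕ} (π : Fin a → Fin a → Equiv.Perm (Fin h))
    (i j : Fin h) (p q : Fin a) :
    (matchedCliques π).Adj (.inl i, p) (.inr j, q) ↔ π p q i = j := Iff.rfl

theorem matchedCliques_neighbors {a h : ℕ} (π : Fin a → Fin a → Equiv.Perm (Fin h))
    (w : (Fin h ⊕ Fin h) × Fin a) :
    ∃ N : Finset ((Fin h ⊕ Fin h) × Fin a), N.card ≤ 2 * a ∧
      ∀ w', (matchedCliques π).Adj w w' → w' ∈ N := by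
  classical
  obtain ⟨b, p⟩ := w
  let f : Fin a → (Fin h ⊕ Fin h) × Fin a := fun q => match b with
    | .inl i => (.inr (π p q i), q)
    | .inr j => (.inl ((π q p).symm j), q)
  refine ⟨univ.image (fun q => (b, q)) ∪ univ.image f, ?_, ?_⟩
  · refine (card_union_le _ _).trans ?_
    have h1 := card_image_le (s := (univ : Finset (Fin a))) (f := fun q => (b, q))
    have h2 := card_image_le (s := (univ : Finset (Fin a))) (f := f)
    rw [card_univ, Fintype.card_fin] at h1 h2
    omega
  · rintro ⟨b', q⟩ hadj
    rw [mem_union, mem_image, mem_image]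
    rcases b with i | i <;> rcases b' with j | j
    · exact Or.inl ⟨q, mem_univ _, by rw [hadj.1]⟩
    · exact Or.inr ⟨q, mem_univ _, by
        have : π p q i = j := hadj
        simp [f, this]⟩
    · exact Or.inr ⟨q, mem_univ _, by
        have : π q p j = i := hadj
        simp [f, ← this]⟩
    · exact Or.inl ⟨q, mem_univ _, by rw [hadj.1]⟩

theorem exists_trace {W : Type*} {a : ℕ} (P : W → Fin a → Prop)
    (hP : ∀ b p q, P b p → P b q → p = q) :
    ∃ T : W → Option (Fin a), ∀ b p, T b = some p ↔ P b p := by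
  classical
  refine ⟨fun b => if hb : ∃ p, P b p then some hb.choose else none, fun b p => ?_⟩
  dsimp only
  split_ifs with hb
  · rw [Option.some_inj]
    exact ⟨fun h => h ▸ hb.choose_spec, fun h => hP b _ _ hb.choose_spec h⟩
  · simpa using fun h => hb ⟨p, h⟩

theorem exists_factorial_pow_le {n a h s d : ℕ} (hs : 0 < s) (had : 2 * a ≤ d)
    (hn : (h + h) * a * s ≤ n) :
    ∃ G : Finset (Finset (Fin n)), (∀ e ∈ G, e.card = 2 * s) ∧ (∀ v, degS G {v} ≤ d) ∧
      h.factorial ^ (a * a) ≤ ((a + 1) ^ (h + h)) ^ vartheta (2 * s) G := by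
  classical
  obtain ⟨φ⟩ : Nonempty ((((Fin h ⊕ Fin h) × Fin a) × Fin s) ↪ Fin n) :=
    Function.Embedding.nonempty_of_card_le (by simpa using hn)
  let B : (Fin h ⊕ Fin h) × Fin a → Finset (Fin n) := fun w => univ.image fun x => φ (w, x)
  have hcard : ∀ w, (B w).card = s := fun w => by
    rw [card_image_of_injective _ fun x y hxy => (Prod.ext_iff.1 (φ.injective hxy)).2]
    simp
  have hne : ∀ w, (B w).Nonempty := fun w => card_pos.1 (by rw [hcard]; exact hs)
  have hB : ∀ w w' v, v ∈ B w → v ∈ B w' → w = w' := by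
    intro w w' v hv hv'
    obtain ⟨x, -, rfl⟩ := mem_image.1 hv
    obtain ⟨y, -, hxy⟩ := mem_image.1 hv'
    exact (Prod.ext_iff.1 (φ.injective hxy)).1.symm
  let G : (Fin a → Fin a → Equiv.Perm (Fin h)) → Finset (Finset (Fin n)) :=
    fun π => blowUp B (matchedCliques π)
  have hG : ∀ π, ∀ e ∈ G π, e.card = 2 * s := fun π e he => card_of_mem_blowUp hcard hB he
  obtain ⟨π₀, hπ₀⟩ := Finite.exists_max fun π => vartheta (2 * s) (G π)
  refine ⟨G π₀, hG π₀, fun v => (degS_blowUp_le hB (matchedCliques_neighbors π₀) v).trans had, ?_⟩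
  have hcode : ∀ π : Fin a → Fin a → Equiv.Perm (Fin h),
      ∃ T : Fin (vartheta (2 * s) (G π₀)) → Fin h ⊕ Fin h → Option (Fin a),
      ∀ (i j : Fin h) (p q : Fin a), π p q i = j ↔ ¬ ∃ l, T l (.inl i) = some p ∧ T l (.inr j) = some q := by
    intro π
    obtain ⟨I, hI, hcov⟩ := exists_cover_of_vartheta_le (by omega) (hG π) (hπ₀ π)
    have hindep : ∀ l w w', B w ⊆ I l → B w' ⊆ I l → ¬ (matchedCliques π).Adj w w' :=
      fun l w w' hw hw' hadj =>
        hI l _ (mem_blowUp.2 ⟨w, w', hadj, rfl⟩) (union_subset hw hw')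
    choose T hT using fun l => exists_trace (fun b p => B (b, p) ⊆ I l) fun b p q hp hq => by
      by_contra hpq
      exact hindep l _ _ hp hq (matchedCliques_adj_of_ne π b hpq)
    refine ⟨T, fun i j p q => ?_⟩
    simp only [hT]
    rw [← matchedCliques_adj_inl_inr π i j p q]
    refine ⟨fun hadj ⟨l, hl⟩ => hindep l _ _ hl.1 hl.2 hadj, fun hno => ?_⟩
    by_contra hadj
    have hww : ((Sum.inl i, p) : (Fin h ⊕ Fin h) × Fin a) ≠ (Sum.inr j, q) := by simp
    rw [← union_mem_blowUp_iff hne hB hww] at hadj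
    obtain ⟨l, hl⟩ := hcov (B (.inl i, p) ∪ B (.inr j, q)) (by
      rw [card_union_of_disjoint, hcard, hcard, two_mul]
      exact disjoint_left.2 fun v hv hv' => hww (hB _ _ v hv hv')) hadj
    exact hno ⟨l, union_subset_left hl, union_subset_right hl⟩
  choose T hT using hcode
  have hinj : Function.Injective T := by
    intro π ρ hπρ
    funext p q
    ext1 i
    rw [hT π, hπρ, ← hT ρ]
  have := Fintype.card_le_of_injective T hinj
  simpa [Fintype.card_perm, ← pow_mul] using this

theorem pow_self_le_factorial_sq (h : ℕ) : h ^ h ≤ h.factorial ^ 2 := by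
  induction h with
  | zero => simp
  | succ h ih =>
    have key : (h + 1) ^ h ≤ (h + 1) * h ^ h := by
      rcases Nat.lt_or_ge h 2 with h2 | h2
      · interval_cases h <;> simp
      · have hpos : (0 : ℝ) < h := by positivity
        have h1 : ((h : ℝ) + 1) ^ h ≤ 3 * (h : ℝ) ^ h := by
          have h3 : (1 + 1 / (h : ℝ)) ^ h ≤ 3 := by
            calc (1 + 1 / (h : ℝ)) ^ h ≤ Real.exp (1 / (h : ℝ)) ^ h := by
                  gcongr
                  linarith [Real.add_one_le_exp (1 / (h : ℝ))]
              _ = Real.exp 1 := by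
                  rw [← Real.exp_nat_mul, mul_one_div_cancel hpos.ne']
              _ ≤ 3 := by linarith [Real.exp_one_lt_d9]
          calc ((h : ℝ) + 1) ^ h = (1 + 1 / (h : ℝ)) ^ h * (h : ℝ) ^ h := by
                rw [← mul_pow, add_mul, one_div_mul_cancel hpos.ne', one_mul]
            _ ≤ 3 * (h : ℝ) ^ h := by gcongr
        have h2' : (h + 1) ^ h ≤ 3 * h ^ h := by exact_mod_cast h1
        exact h2'.trans (Nat.mul_le_mul_right _ (by omega))
    calc (h + 1) ^ (h + 1) = (h + 1) * (h + 1) ^ h := by ring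
      _ ≤ (h + 1) * ((h + 1) * h ^ h) := by gcongr
      _ ≤ (h + 1) * ((h + 1) * h.factorial ^ 2) := by gcongr
      _ = (h + 1).factorial ^ 2 := by rw [Nat.factorial_succ]; ring

theorem log_le_of_factorial_pow_le {a h t : ℕ} (hh : 0 < h)
    (H : h.factorial ^ (a * a) ≤ ((a + 1) ^ (h + h)) ^ t) :
    (a : ℝ) ^ 2 * Real.log h ≤ 4 * t * Real.log (a + 1) := by
  have hpos : (0 : ℝ) < h := by exact_mod_cast hh
  have hfac : (h : ℝ) * Real.log h ≤ 2 * Real.log h.factorial := by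
    have := Real.log_le_log (by positivity)
      (show (h : ℝ) ^ h ≤ (h.factorial : ℝ) ^ 2 by exact_mod_cast pow_self_le_factorial_sq h)
    rwa [Real.log_pow, Real.log_pow, Nat.cast_ofNat] at this
  have hlog := Real.log_le_log (by positivity)
    (show (h.factorial : ℝ) ^ (a * a) ≤ (((a : ℝ) + 1) ^ (h + h)) ^ t by exact_mod_cast H)
  rw [Real.log_pow, Real.log_pow, Real.log_pow] at hlog
  push_cast at hlog
  refine le_of_mul_le_mul_left ?_ hpos
  have := mul_le_mul_of_nonneg_left hfac (sq_nonneg (a : ℝ))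
  linarith

theorem one_le_vartheta_empty {n k : ℕ} (hkn : k ≤ n) :
    1 ≤ vartheta k (∅ : Finset (Finset (Fin n))) := by
  obtain ⟨I, -, hcov⟩ := exists_cover_vartheta (k := k) (G := (∅ : Finset (Finset (Fin n))))
    (by simp)
  obtain ⟨e, -, he⟩ := exists_subset_card_eq (s := (univ : Finset (Fin n))) (n := k) (by simpa)
  obtain ⟨j, -⟩ := hcov e he (by simp)
  exact Nat.one_le_of_lt j.2

/-- There is a positive constant `c` such that for all `n, d ≥ 2` and all even `k ≥ 2` there is
a `k`-graph `G` on `n` vertices with `Δ(G) ≤ d` and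
`ϑ(G) ≥ c (d²/log d) log (2n/(kd))`. -/
theorem even_lower_bound :
    ∃ c : ℝ, 0 < c ∧ ∀ n d k : ℕ, 2 ≤ n → 2 ≤ d → 2 ≤ k → Even k →
      ∃ G : Finset (Finset (Fin n)), (∀ e ∈ G, e.card = k) ∧
        (∀ v : Fin n, degS G {v} ≤ d) ∧
        c * ((d : ℝ) ^ 2 / Real.log d) *
            Real.log (2 * (n : ℝ) / ((k : ℝ) * (d : ℝ))) ≤ (vartheta k G : ℝ) := by
  refine ⟨1 / 512, by norm_num, fun n d k hn hd hk hke => ?_⟩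
  obtain ⟨s, rfl⟩ := hke.two_dvd
  have hs : 0 < s := by omega
  have hd2 : (2 : ℝ) ≤ d := by exact_mod_cast hd
  have hsR : (0 : ℝ) < s := by exact_mod_cast hs
  have hlogd : 0 < Real.log d := Real.log_pos (by linarith)
  have hx : 2 * (n : ℝ) / (((2 * s : ℕ) : ℝ) * d) = n / (s * d) := by
    push_cast
    rw [mul_assoc, mul_div_mul_left _ _ two_ne_zero]
  rw [hx]
  have hsd : (0 : ℝ) < s * d := by positivity
  rcases le_or_gt ((n : ℝ) / (s * d)) 1 with hle | hgt
  · refine ⟨∅, by simp, by simp [degS], le_trans ?_ (Nat.cast_nonneg _)⟩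
    exact mul_nonpos_of_nonneg_of_nonpos (by positivity)
      (Real.log_nonpos (by positivity) hle)
  have hnsd : s * d < n := by
    rw [one_lt_div hsd] at hgt
    exact_mod_cast hgt
  obtain ⟨a, ha1, had, had8, had1, h4⟩ : ∃ a : ℕ, 1 ≤ a ∧ 2 * a ≤ d ∧ d ≤ 8 * a ∧ a + 1 ≤ d ∧
      (4 * a ≤ d ∨ a = 1 ∧ d ≤ 3) := by
    rcases Nat.lt_or_ge d 4 with h | h
    · exact ⟨1, by omega, by omega, by omega, by omega, by omega⟩
    · exact ⟨d / 4, by omega, by omega, by omega, by omega, by omega⟩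
  have hM : 0 < 2 * a * s := by positivity
  obtain ⟨h, hh⟩ : ∃ h, h = n / (2 * a * s) := ⟨_, rfl⟩
  have hn1 : (h + h) * a * s ≤ n := by
    have := Nat.div_mul_le_self n (2 * a * s)
    rw [← hh] at this
    linarith
  have hn2 : n < (h + 1) * (2 * a * s) := by
    rw [hh]
    exact Nat.lt_mul_of_div_lt (Nat.lt_succ_self _) hM
  have hxh : (n : ℝ) / (s * d) ≤ h + 1 := by
    rw [div_le_iff₀ hsd]
    have h1 : (h + 1) * (2 * a * s) ≤ (h + 1) * (s * d) := by
      refine Nat.mul_le_mul_left _ ?_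
      rw [mul_comm s d]
      gcongr
    exact_mod_cast hn2.le.trans h1
  rcases Nat.lt_or_ge h 2 with hlt | hge
  · refine ⟨∅, by simp, by simp [degS], ?_⟩
    have hd3 : d ≤ 3 := by
      rcases h4 with h4 | h4
      · have : (h + 1) * (2 * a * s) ≤ s * d := by
          calc (h + 1) * (2 * a * s) ≤ 2 * (2 * a * s) := by gcongr; omega
            _ = s * (4 * a) := by ring
            _ ≤ s * d := by gcongr
        omega
      · exact h4.2
    have hkn : 2 * s ≤ n := by nlinarith
    have hone : (1 : ℝ) ≤ (vartheta (2 * s) (∅ : Finset (Finset (Fin n))) : ℝ) := by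
      exact_mod_cast one_le_vartheta_empty hkn
    refine le_trans ?_ hone
    have hlogx : Real.log ((n : ℝ) / (s * d)) ≤ Real.log d := by
      refine Real.log_le_log (by linarith) (hxh.trans ?_)
      have : (h : ℝ) ≤ 1 := by exact_mod_cast Nat.lt_succ_iff.1 hlt
      linarith
    have hd3R : (d : ℝ) ≤ 3 := by exact_mod_cast hd3
    calc 1 / 512 * ((d : ℝ) ^ 2 / Real.log d) * Real.log ((n : ℝ) / (s * d))
        ≤ 1 / 512 * ((d : ℝ) ^ 2 / Real.log d) * Real.log d := by gcongr
      _ = (d : ℝ) ^ 2 / 512 := by field_simp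
      _ ≤ 1 := by nlinarith
  · obtain ⟨G, hG, hdeg, hcount⟩ := exists_factorial_pow_le hs had hn1
    refine ⟨G, hG, hdeg, ?_⟩
    have hmain := log_le_of_factorial_pow_le (by omega) hcount
    set t : ℝ := (vartheta (2 * s) G : ℝ) with ht
    have ht0 : 0 ≤ t := Nat.cast_nonneg _
    have hge' : (2 : ℝ) ≤ h := by exact_mod_cast hge
    have hlogx : Real.log ((n : ℝ) / (s * d)) ≤ 2 * Real.log h := by
      have := Real.log_le_log (by linarith) (hxh.trans (show (h : ℝ) + 1 ≤ (h : ℝ) ^ 2 by nlinarith))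
      rwa [Real.log_pow, Nat.cast_ofNat] at this
    have hloga : Real.log ((a : ℝ) + 1) ≤ Real.log d :=
      Real.log_le_log (by positivity) (by exact_mod_cast had1)
    have hlogh : 0 ≤ Real.log h := Real.log_nonneg (by linarith)
    have had8R : (d : ℝ) ≤ 8 * a := by exact_mod_cast had8
    have hda : (d : ℝ) ^ 2 ≤ 64 * (a : ℝ) ^ 2 := by nlinarith
    rw [mul_div_assoc', div_mul_eq_mul_div, div_le_iff₀ hlogd]
    calc 1 / 512 * (d : ℝ) ^ 2 * Real.log ((n : ℝ) / (s * d))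
        ≤ 1 / 512 * (64 * (a : ℝ) ^ 2) * (2 * Real.log h) := by
          have := Real.log_pos hgt
          gcongr
      _ = (a : ℝ) ^ 2 * Real.log h / 4 := by ring
      _ ≤ 4 * t * Real.log (a + 1) / 4 := by gcongr
      _ = t * Real.log (a + 1) := by ring
      _ ≤ t * Real.log d := by gcongr
end
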